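/- Let F : ℝ → [0, ∞) be a Lebesgue integrable function that vanishes outside some interval of length at most 3/4. Then ∫_0^{π/2} ∫_ℝ F(t + (3/4)(1 − cos ψ)) · F(t + (3/4)(1 − sin ψ)) dt dψ ≥ (2√2/3) · (∫_ℝ F(t) dt)². -/

import Mathlib

open MeasureTheory Real Set

lemma convolution_comp_neg_self (F : ℝ → ℝ) :
    convolution (fun t ↦ F (-t)) F (ContinuousLinearMap.mul ℝ ℝ) volume =
      fun s ↦ ∫ x, F x * F (x + s) := by
  ext s
  rw [convolution_def, ← integral_neg_eq_self]
  simp [add_comm]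

lemma integrable_autocorrelation {F : ℝ → ℝ} (hF : Integrable F) :
    Integrable (fun s ↦ ∫ x, F x * F (x + s)) :=
  convolution_comp_neg_self F ▸
    hF.comp_neg.integrable_convolution (ContinuousLinearMap.mul ℝ ℝ) hF

lemma integral_autocorrelation {F : ℝ → ℝ} (hF : Integrable F) :
    ∫ s, ∫ x, F x * F (x + s) = (∫ t, F t) ^ 2 := by
  have h := integral_convolution (ContinuousLinearMap.mul ℝ ℝ) hF.comp_neg hF
  rwa [integral_neg_eq_self, ContinuousLinearMap.mul_apply', ← sq,
    convolution_comp_neg_self] at h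

lemma autocorrelation_eq_zero {F : ℝ → ℝ} {a b c s : ℝ} (hab : b - a ≤ c)
    (h0 : ∀ t ∉ Icc a b, F t = 0) (hs : s ∉ Icc (-c) c) : ∫ x, F x * F (x + s) = 0 := by
  refine integral_eq_zero_of_ae (.of_forall fun x ↦ ?_)
  by_contra h
  obtain ⟨h1, h2⟩ := mul_ne_zero_iff.1 h
  have hx := not_imp_comm.1 (h0 x) h1
  have hy := not_imp_comm.1 (h0 (x + s)) h2
  exact hs ⟨by linarith [hx.2, hy.1], by linarith [hx.1, hy.2]⟩

lemma hasDerivAt_mul_cos_sub_sin (c x : ℝ) :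
    HasDerivAt (fun ψ ↦ c * (cos ψ - sin ψ)) (-(c * (cos x + sin x))) x := by
  refine (((hasDerivAt_cos x).sub (hasDerivAt_sin x)).const_mul c).congr_deriv ?_
  ring

lemma cos_add_sin_pos {x : ℝ} (hx : x ∈ Icc 0 (π / 2)) : 0 < cos x + sin x := by
  have hc := cos_nonneg_of_mem_Icc ⟨by linarith [hx.1, pi_pos], hx.2⟩
  have hs := sin_nonneg_of_nonneg_of_le_pi hx.1 (by linarith [hx.2, pi_pos])
  nlinarith [sin_sq_add_cos_sq x]

lemma cos_add_sin_le_sqrt_two (x : ℝ) : cos x + sin x ≤ √2 :=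
  le_sqrt_of_sq_le (by nlinarith [sin_sq_add_cos_sq x, sq_nonneg (cos x - sin x)])

lemma strictAntiOn_mul_cos_sub_sin {c : ℝ} (hc : 0 < c) :
    StrictAntiOn (fun ψ ↦ c * (cos ψ - sin ψ)) (Icc 0 (π / 2)) := by
  refine strictAntiOn_of_deriv_neg (convex_Icc _ _) (by fun_prop) fun x hx ↦ ?_
  rw [(hasDerivAt_mul_cos_sub_sin c x).deriv]
  exact neg_neg_of_pos (mul_pos hc (cos_add_sin_pos (interior_subset hx)))

lemma Icc_subset_image_mul_cos_sub_sin (c : ℝ) :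
    Icc (-c) c ⊆ (fun ψ ↦ c * (cos ψ - sin ψ)) '' Icc 0 (π / 2) := by
  have h := intermediate_value_Icc' (f := fun ψ ↦ c * (cos ψ - sin ψ))
    (by positivity : (0 : ℝ) ≤ π / 2) (by fun_prop)
  simpa using h

/-- Change-of-variables estimate: if `F : ℝ → [0, ∞)` is integrable and vanishes outside
an interval of length at most `3/4`, then
`∫_0^{π/2} ∫_ℝ F(t + (3/4)(1 − cos ψ)) F(t + (3/4)(1 − sin ψ)) dt dψ ≥ (2√2/3) (∫ F)²`. -/
theorem overlap_change_of_variables (F : ℝ → ℝ)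
    (hF : Integrable F) (hF_nonneg : ∀ t, 0 ≤ F t)
    (hF_supp : ∃ a b : ℝ, b - a ≤ 3 / 4 ∧ ∀ t ∉ Set.Icc a b, F t = 0) :
    (2 * Real.sqrt 2 / 3) * (∫ t, F t) ^ 2 ≤
      ∫ ψ in (0 : ℝ)..(π / 2),
        ∫ t, F (t + 3 / 4 * (1 - Real.cos ψ)) * F (t + 3 / 4 * (1 - Real.sin ψ)) := by
  obtain ⟨a, b, hab, h0⟩ := hF_supp
  set A : ℝ → ℝ := fun s ↦ ∫ x, F x * F (x + s) with hA
  set σ : ℝ → ℝ := fun ψ ↦ 3 / 4 * (cos ψ - sin ψ) with hσ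
  set I : Set ℝ := Icc 0 (π / 2)
  have hinner (ψ : ℝ) :
      ∫ t, F (t + 3 / 4 * (1 - cos ψ)) * F (t + 3 / 4 * (1 - sin ψ)) = A (σ ψ) := by
    have harg (t : ℝ) :
        t + 3 / 4 * (1 - cos ψ) + σ ψ = t + 3 / 4 * (1 - sin ψ) := by
      simp only [hσ]
      ring
    simpa only [harg] using
      integral_add_right_eq_self (fun x ↦ F x * F (x + σ ψ)) (3 / 4 * (1 - cos ψ))
  have hderiv : ∀ x ∈ I, HasDerivWithinAt σ (-(3 / 4 * (cos x + sin x))) I x :=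
    fun x _ ↦ (hasDerivAt_mul_cos_sub_sin _ x).hasDerivWithinAt
  have hinj : InjOn σ I := (strictAntiOn_mul_cos_sub_sin (by norm_num)).injOn
  have habs : ∀ x ∈ I, |-(3 / 4 * (cos x + sin x))| = 3 / 4 * (cos x + sin x) := fun x hx ↦ by
    rw [abs_neg, abs_of_pos (mul_pos (by norm_num) (cos_add_sin_pos hx))]
  have hint : IntegrableOn (fun x ↦ 3 / 4 * (cos x + sin x) * A (σ x)) I := by
    refine ((integrableOn_image_iff_integrableOn_abs_deriv_smul measurableSet_Icc hderiv hinj A).1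
      (integrable_autocorrelation hF).integrableOn).congr_fun (fun x hx ↦ ?_) measurableSet_Icc
    simp only [habs x hx, smul_eq_mul]
  have hval : ∫ x in I, 3 / 4 * (cos x + sin x) * A (σ x) = (∫ t, F t) ^ 2 := by
    rw [← integral_autocorrelation hF, ← setIntegral_eq_integral_of_forall_compl_eq_zero
      (s := σ '' I) fun s hs ↦ autocorrelation_eq_zero hab h0
        fun h ↦ hs (Icc_subset_image_mul_cos_sub_sin _ h),
      integral_image_eq_integral_abs_deriv_smul measurableSet_Icc hderiv hinj]
    refine setIntegral_congr_fun measurableSet_Icc fun x hx ↦ ?_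
    simp only [habs x hx, smul_eq_mul, hA]
  have hintA : IntegrableOn (fun x ↦ A (σ x)) I := by
    have hcont : ContinuousOn (fun x ↦ (3 / 4 * (cos x + sin x))⁻¹) I :=
      ContinuousOn.inv₀ (by fun_prop) fun x hx ↦
        (mul_pos (by norm_num) (cos_add_sin_pos hx)).ne'
    refine (hint.continuousOn_mul hcont isCompact_Icc).congr_fun (fun x hx ↦ ?_) measurableSet_Icc
    exact inv_mul_cancel_left₀ (mul_pos (by norm_num) (cos_add_sin_pos hx)).ne' _
  simp only [hinner]
  rw [intervalIntegral.integral_of_le (by positivity), ← integral_Icc_eq_integral_Ioc, ← hval,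
    ← integral_const_mul]
  refine setIntegral_mono_on (hint.const_mul _) hintA measurableSet_Icc fun x _ ↦ ?_
  rw [← mul_assoc]
  refine mul_le_of_le_one_left (integral_nonneg fun t ↦ mul_nonneg (hF_nonneg _) (hF_nonneg _)) ?_
  nlinarith [cos_add_sin_le_sqrt_two x, sq_sqrt (zero_le_two (α := ℝ)), sqrt_nonneg (2 : ℝ)]
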